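/- Fix d ≥ 1, u₀ > 0, p ∈ [1,∞] and a ∈ (0,2). For δ ∈ (0,1) and twice continuously differentiable φ : ℝ^d → ℝ with ‖φ‖_p and max_{|κ|=2} ‖∂_κ φ‖_p finite, define D^δ φ(x) := u₀ V₁ ∫_δ^∞ ( φ̄(x,r) − φ(x) ) dr/r^{1+a} and D⁰ φ(x) := u₀ V₁ ∫₀^∞ ( φ̄(x,r) − φ(x) ) dr/r^{1+a}. Then ‖ D^δ φ − D⁰ φ ‖_p ≤ ( u₀ V₁ d / (2(2−a)) ) · δ^{2−a} · max_{|κ|=2} ‖∂_κ φ‖_p. -/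

import Mathlib

open MeasureTheory Metric Set
open scoped ENNReal

noncomputable section

/-- Euclidean space `ℝ^d`. -/
abbrev Euc (d : ℕ) : Type := EuclideanSpace ℝ (Fin d)

/-- The ball average `φ̄(x,r) = (1/V_r) ∫_{B(x,r)} φ(y) dy` (with `φ̄(x,0) = φ(x)`). -/
def ballAvg {d : ℕ} (φ : Euc d → ℝ) (r : ℝ) (x : Euc d) : ℝ :=
  if r = 0 then φ x
  else ((volume (Metric.ball x r)).toReal)⁻¹ * ∫ y in Metric.ball x r, φ y

/-- The double ball average `φ̄̄(x,r,s) = (1/(V_r V_s)) ∫_{B(x,r)} ∫_{B(y,s)} φ(z) dz dy`. -/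
def doubleAvg {d : ℕ} (φ : Euc d → ℝ) (r s : ℝ) (x : Euc d) : ℝ :=
  ballAvg (ballAvg φ s) r x

/-- Partial derivative of `ψ` in the `i`-th coordinate direction. -/
def pd {d : ℕ} (i : Fin d) (ψ : Euc d → ℝ) (x : Euc d) : ℝ :=
  fderiv ℝ ψ x (EuclideanSpace.single i 1)

/-- Iterated partial derivative `∂_κ` along a list of coordinate directions. -/
def listD {d : ℕ} : List (Fin d) → (Euc d → ℝ) → Euc d → ℝ
  | [], ψ => ψ
  | i :: l, ψ => pd i (listD l ψ)

/-- The Laplacian `Δφ = ∑ i ∂²φ/∂x_i²`. -/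
def lap {d : ℕ} (φ : Euc d → ℝ) (x : Euc d) : ℝ := ∑ i : Fin d, listD [i, i] φ x

/-- The volume of the unit ball in `ℝ^d`. -/
def V1 (d : ℕ) : ℝ := (volume (Metric.ball (0 : Euc d) 1)).toReal

/-- `max_{|κ| ≤ n} ‖∂_κ φ‖_p`. -/
def maxDle {d : ℕ} (n : ℕ) (φ : Euc d → ℝ) (p : ℝ≥0∞) : ℝ≥0∞ :=
  ⨆ (l : List (Fin d)) (_ : l.length ≤ n), eLpNorm (listD l φ) p volume



open scoped Pointwise

lemma mink_aux {α Ω : Type*} [MeasurableSpace α] [MeasurableSpace Ω] (μ : Measure α) [SFinite μ]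
    (ν : Measure Ω) [SFinite ν] (G : α → Ω → ℝ≥0∞) (hG : Measurable (Function.uncurry G))
    (p : ℝ≥0∞) (hp : 1 ≤ p) (M : ℝ≥0∞)
    (hM : ∀ᵐ ω ∂ν, eLpNorm (fun x => G x ω) p μ ≤ M) :
    eLpNorm (fun x => ∫⁻ ω, G x ω ∂ν) p μ ≤ ν univ * M := by
  rcases eq_or_ne p ⊤ with rfl | hpt
  · simp only [eLpNorm_exponent_top] at hM ⊢
    apply eLpNormEssSup_le_of_ae_enorm_bound
    have h1 : ∀ᵐ ω ∂ν, ∀ᵐ x ∂μ, G x ω ≤ M := by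
      filter_upwards [hM] with ω hω
      filter_upwards [ae_le_eLpNormEssSup (f := fun x => G x ω) (μ := μ)] with x hx
      exact le_trans hx hω
    rw [Measure.ae_ae_comm] at h1
    · filter_upwards [h1] with x hx
      calc (∫⁻ ω, G x ω ∂ν) ≤ ∫⁻ ω, M ∂ν := lintegral_mono_ae hx
        _ = ν univ * M := by rw [lintegral_const, mul_comm]
    · exact measurableSet_le (hG.comp measurable_swap) measurable_const
  · have hp0 : p ≠ 0 := (zero_lt_one.trans_le hp).ne'
    set q := p.toReal with hq
    have hq1 : 1 ≤ q := by
      rw [hq, ← ENNReal.toReal_one]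
      exact ENNReal.toReal_mono hpt hp
    have hq0 : 0 < q := by linarith
    have hqi : q * (1 / q) = 1 := by field_simp
    rw [eLpNorm_eq_lintegral_rpow_enorm_toReal hp0 hpt]
    have key : ∀ x, (∫⁻ ω, G x ω ∂ν) ^ q ≤ (∫⁻ ω, G x ω ^ q ∂ν) * ν univ ^ (q - 1) := by
      intro x
      have h := eLpNorm_le_eLpNorm_mul_rpow_measure_univ (μ := ν) (f := fun ω => G x ω) hp
        (hG.of_uncurry_left).aestronglyMeasurable
      rw [eLpNorm_one_eq_lintegral_enorm, eLpNorm_eq_lintegral_rpow_enorm_toReal hp0 hpt] at h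
      simp only [enorm_eq_self, ENNReal.toReal_one] at h
      refine (ENNReal.rpow_le_rpow h hq0.le).trans ?_
      rw [ENNReal.mul_rpow_of_nonneg _ _ hq0.le, ← ENNReal.rpow_mul, ← ENNReal.rpow_mul]
      rw [show 1 / p.toReal * q = 1 by rw [mul_comm]; exact hqi,
        show (1 / 1 - 1 / p.toReal) * q = q - 1 by rw [← hq]; field_simp]
      simp [← hq]
    have h2 : (∫⁻ x, ‖∫⁻ ω, G x ω ∂ν‖ₑ ^ p.toReal ∂μ) ≤ (ν univ * M) ^ q := by
      calc (∫⁻ x, ‖∫⁻ ω, G x ω ∂ν‖ₑ ^ p.toReal ∂μ)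
          ≤ ∫⁻ x, (∫⁻ ω, G x ω ^ q ∂ν) * ν univ ^ (q - 1) ∂μ := lintegral_mono (fun x => key x)
        _ = (∫⁻ x, (∫⁻ ω, G x ω ^ q ∂ν) ∂μ) * ν univ ^ (q - 1) := by
            rw [lintegral_mul_const]
            exact (hG.pow_const q).lintegral_prod_right
        _ = (∫⁻ ω, (∫⁻ x, G x ω ^ q ∂μ) ∂ν) * ν univ ^ (q - 1) := by
            rw [lintegral_lintegral_swap]
            exact (hG.pow_const q).aemeasurable
        _ ≤ (∫⁻ ω, M ^ q ∂ν) * ν univ ^ (q - 1) := by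
            gcongr ?_ * _
            apply lintegral_mono_ae
            filter_upwards [hM] with ω hω
            rw [eLpNorm_eq_lintegral_rpow_enorm_toReal hp0 hpt] at hω
            have := ENNReal.rpow_le_rpow hω hq0.le
            rw [← ENNReal.rpow_mul, show 1 / p.toReal * q = 1 by rw [mul_comm]; exact hqi] at this
            simpa using this
        _ = (ν univ * M) ^ q := by
            rw [lintegral_const, ENNReal.mul_rpow_of_nonneg _ _ hq0.le,
              show ν univ ^ q = ν univ ^ (1 + (q - 1)) by congr 1; ring,
              ENNReal.rpow_add_of_nonneg _ _ zero_le_one (by linarith), ENNReal.rpow_one]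
            ring
    calc _ ≤ ((ν univ * M) ^ q) ^ (1 / p.toReal) := ENNReal.rpow_le_rpow h2 (by positivity)
      _ = ν univ * M := by rw [← ENNReal.rpow_mul, hqi, ENNReal.rpow_one]

lemma hasDerivAt_line {d : ℕ} (ψ : Euc d → ℝ) (hψ : Differentiable ℝ ψ) (x v : Euc d) (t : ℝ) :
    HasDerivAt (fun s : ℝ => ψ (x + s • v)) (∑ i, v i * pd i ψ (x + t • v)) t := by
  have h1 : HasDerivAt (fun s : ℝ => x + s • v) v t := by
    simpa using ((hasDerivAt_id t).smul_const v).const_add x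
  have h2 := (hψ (x + t • v)).hasFDerivAt.comp_hasDerivAt t h1
  have h3 : (fderiv ℝ ψ (x + t • v)) v = ∑ i, v i * pd i ψ (x + t • v) := by
    have h4 := congrArg (fderiv ℝ ψ (x + t • v)) ((EuclideanSpace.basisFun (Fin d) ℝ).sum_repr v)
    rw [← h4]
    simp [pd]
  rw [← h3]
  exact h2

lemma contDiff_pd {d : ℕ} (i : Fin d) (ψ : Euc d → ℝ) (m n : ℕ∞) (hmn : m + 1 ≤ n)
    (h : ContDiff ℝ n ψ) : ContDiff ℝ m (pd i ψ) := by
  unfold pd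
  exact (h.fderiv_right (by exact_mod_cast hmn)).clm_apply contDiff_const

lemma cont_pdpd {d : ℕ} (φ : Euc d → ℝ) (hφ : ContDiff ℝ 2 φ) (i j : Fin d) :
    Continuous (pd i (pd j φ)) := by
  have h1 : ContDiff ℝ (1:ℕ∞) (pd j φ) := contDiff_pd j φ 1 2 (by norm_num) (by exact_mod_cast hφ)
  have h2 : ContDiff ℝ (0:ℕ∞) (pd i (pd j φ)) := contDiff_pd i _ 0 1 (by norm_num) h1
  exact h2.continuous

def Tm : Measure ℝ := (volume.restrict (Ioc (0:ℝ) 1)).withDensity (fun t => ENNReal.ofReal (1 - t))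

def Kf {d : ℕ} (φ : Euc d → ℝ) (x v z : Euc d) : ℝ :=
  ∑ i, ∑ j, v i * v j * pd i (pd j φ) (x + z)

lemma taylor_aux {d : ℕ} (φ : Euc d → ℝ) (hφ : ContDiff ℝ 2 φ) (x v : Euc d) :
    ‖φ (x + v) - φ x - ∑ j, v j * pd j φ x‖ₑ ≤ ∫⁻ t, ‖Kf φ x v (t • v)‖ₑ ∂Tm := by
  have hc := cont_pdpd φ hφ
  have hd1 : ∀ j, Differentiable ℝ (pd j φ) := fun j => by
    have h1 : ContDiff ℝ (1:ℕ∞) (pd j φ) :=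
      contDiff_pd j φ 1 2 (by norm_num) (by exact_mod_cast hφ)
    exact h1.differentiable (by norm_num)
  have hd0 : Differentiable ℝ φ := hφ.differentiable (by norm_num)
  have hder : ∀ t : ℝ, HasDerivAt
      (fun s : ℝ => φ (x + s • v) + (1 - s) * ∑ j, v j * pd j φ (x + s • v))
      ((1 - t) * Kf φ x v (t • v)) t := by
    intro t
    have h0 := hasDerivAt_line φ hd0 x v t
    have h1 : HasDerivAt (fun s : ℝ => ∑ j, v j * pd j φ (x + s • v))
        (∑ j, v j * ∑ i, v i * pd i (pd j φ) (x + t • v)) t :=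
      HasDerivAt.fun_sum (fun j _ => (hasDerivAt_line (pd j φ) (hd1 j) x v t).const_mul (v j))
    have h2 : HasDerivAt (fun s : ℝ => 1 - s) (-1) t := by
      simpa using (hasDerivAt_id t).const_sub 1
    have h3 := h0.add (h2.mul h1)
    have : Kf φ x v (t • v) = ∑ j, v j * ∑ i, v i * pd i (pd j φ) (x + t • v) := by
      unfold Kf
      rw [Finset.sum_comm]
      refine Finset.sum_congr rfl fun j _ => ?_
      rw [Finset.mul_sum]
      exact Finset.sum_congr rfl fun i _ => by ring
    rw [this]
    refine h3.congr_deriv ?_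
    ring
  have hcont : Continuous fun t : ℝ => (1 - t) * Kf φ x v (t • v) := by
    unfold Kf
    have := fun i j => hc i j
    fun_prop
  have hint := intervalIntegral.integral_eq_sub_of_hasDerivAt (a := 0) (b := 1)
    (fun t _ => hder t) (hcont.intervalIntegrable 0 1)
  have e : φ (x + v) - φ x - ∑ j, v j * pd j φ x = ∫ t in Ioc (0:ℝ) 1, (1 - t) * Kf φ x v (t • v) := by
    rw [← intervalIntegral.integral_of_le zero_le_one, hint]
    simp; ring
  rw [e]
  refine (enorm_integral_le_lintegral_enorm _).trans ?_
  unfold Tm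
  rw [lintegral_withDensity_eq_lintegral_mul₀]
  · apply lintegral_mono_ae
    filter_upwards [ae_restrict_mem measurableSet_Ioc] with t ht
    simp only [Pi.mul_apply, enorm_mul]
    gcongr
    rw [Real.enorm_eq_ofReal (by linarith [ht.2])]
  · fun_prop
  · have : Continuous fun t : ℝ => Kf φ x v (t • v) := by
      unfold Kf
      have := fun i j => hc i j
      fun_prop
    exact this.enorm.measurable.aemeasurable

lemma Tm_univ : Tm univ = ENNReal.ofReal (1 / 2) := by
  unfold Tm
  rw [withDensity_apply _ MeasurableSet.univ, Measure.restrict_univ,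
    ← ofReal_integral_eq_lintegral_ofReal]
  · rw [← intervalIntegral.integral_of_le zero_le_one]
    congr 1
    rw [intervalIntegral.integral_sub (by simp) (by simp)]
    norm_num [integral_id]
  · exact (Continuous.integrableOn_Icc (by fun_prop)).mono_set Ioc_subset_Icc_self
  · filter_upwards [ae_restrict_mem measurableSet_Ioc] with t ht
    simpa using ht.2

def Pm (d : ℕ) : Measure (Euc d) :=
  (volume (Metric.ball (0 : Euc d) 1))⁻¹ • volume.restrict (Metric.ball (0 : Euc d) 1)

instance (d : ℕ) : IsProbabilityMeasure (Pm d) := by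
  constructor
  simp only [Pm, Measure.smul_apply, Measure.restrict_apply_univ, smul_eq_mul]
  exact ENNReal.inv_mul_cancel (measure_ball_pos _ _ one_pos).ne' measure_ball_lt_top.ne

instance : SFinite Tm := by unfold Tm; infer_instance

lemma integrable_Pm {d : ℕ} (f : Euc d → ℝ) (hf : Continuous f) : Integrable f (Pm d) := by
  unfold Pm
  apply Integrable.smul_measure
  · exact (hf.continuousOn.integrableOn_compact (isCompact_closedBall 0 1)).mono_set
      ball_subset_closedBall
  · exact ENNReal.inv_ne_top.2 (measure_ball_pos _ _ one_pos).ne'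

lemma ballAvg_eq {d : ℕ} (φ : Euc d → ℝ) (x : Euc d) (r : ℝ) (hr : 0 < r) :
    ballAvg φ r x = ∫ y, φ (x + r • y) ∂Pm d := by
  unfold ballAvg Pm
  rw [if_neg hr.ne', integral_smul_measure, Measure.setIntegral_comp_smul_of_pos volume
    (fun z => φ (x + z)) _ hr, Measure.addHaar_ball_of_pos volume x hr]
  have : (∫ z in (r • ball (0 : Euc d) 1 : Set (Euc d)), φ (x + z)) = ∫ y in ball x r, φ y := by
    rw [smul_unitBall_of_pos hr]
    rw [← (measurePreserving_add_left volume x).setIntegral_preimage_emb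
      (measurableEmbedding_addLeft x) φ (ball x r)]
    congr 2
    ext z; simp
  rw [this]
  simp only [ENNReal.toReal_mul, ENNReal.toReal_inv, smul_eq_mul]
  rw [ENNReal.toReal_ofReal (by positivity)]
  rw [mul_inv]; ring

lemma Pm_odd {d : ℕ} (j : Fin d) : ∫ y, y j ∂Pm d = 0 := by
  unfold Pm
  rw [integral_smul_measure]
  have : (∫ y in ball (0 : Euc d) 1, y j) = 0 := by
    have h := (Measure.measurePreserving_neg (volume : Measure (Euc d))).setIntegral_preimage_emb
      (MeasurableEquiv.neg (Euc d)).measurableEmbedding (fun y => y j) (ball (0 : Euc d) 1)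
    have h2 : (Neg.neg ⁻¹' ball (0 : Euc d) 1) = ball (0 : Euc d) 1 := by ext z; simp
    rw [h2] at h
    simp only [PiLp.neg_apply, integral_neg] at h
    linarith
  rw [this, smul_zero]

lemma ballAvg_bound {d : ℕ} (φ : Euc d → ℝ) (hφ : ContDiff ℝ 2 φ) (x : Euc d) (r : ℝ) (hr : 0 < r) :
    ‖ballAvg φ r x - φ x‖ₑ ≤ ENNReal.ofReal (r ^ 2) *
      ∫⁻ y, ∫⁻ t, ‖Kf φ x y (t • r • y)‖ₑ ∂Tm ∂Pm d := by
  have hc := hφ.continuous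
  have e : ballAvg φ r x - φ x =
      ∫ y, (φ (x + r • y) - φ x - ∑ j, (r • y) j * pd j φ x) ∂Pm d := by
    rw [integral_sub, integral_sub, ballAvg_eq φ x r hr, integral_finsetSum]
    · have : ∀ j, ∫ y, (r • y) j * pd j φ x ∂Pm d = 0 := fun j => by
        simp only [PiLp.smul_apply, smul_eq_mul]
        rw [integral_mul_const, integral_const_mul, Pm_odd]; simp
      rw [Finset.sum_congr rfl fun j _ => this j]; simp
    · intro j _
      exact integrable_Pm _ (by fun_prop)
    · exact integrable_Pm _ (by fun_prop)
    · exact integrable_Pm _ (by fun_prop)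
    · exact integrable_Pm _ (by fun_prop)
    · exact integrable_Pm _ (by fun_prop)
  rw [e]
  refine (enorm_integral_le_lintegral_enorm _).trans ?_
  rw [← lintegral_const_mul' _ _ ENNReal.ofReal_ne_top]
  apply lintegral_mono
  intro y
  refine (taylor_aux φ hφ x (r • y)).trans ?_
  dsimp only
  rw [← lintegral_const_mul' _ _ ENNReal.ofReal_ne_top]
  apply lintegral_mono
  intro t
  have : Kf φ x (r • y) (t • r • y) = r ^ 2 * Kf φ x y (t • r • y) := by
    unfold Kf
    simp only [Finset.mul_sum, PiLp.smul_apply, smul_eq_mul]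
    exact Finset.sum_congr rfl fun i _ => Finset.sum_congr rfl fun j _ => by ring
  dsimp only
  rw [this, enorm_mul, Real.enorm_eq_ofReal (by positivity)]

def Rm (a δ : ℝ) : Measure ℝ :=
  (volume.restrict (Ioc (0:ℝ) δ)).withDensity (fun r => ENNReal.ofReal (r ^ (1 - a)))

instance (a δ : ℝ) : SFinite (Rm a δ) := by unfold Rm; infer_instance

lemma Rm_univ (a δ : ℝ) (ha : a < 2) (hδ : 0 < δ) :
    Rm a δ univ = ENNReal.ofReal (δ ^ (2 - a) / (2 - a)) := by
  unfold Rm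
  rw [withDensity_apply _ MeasurableSet.univ, Measure.restrict_univ,
    ← ofReal_integral_eq_lintegral_ofReal]
  · rw [← intervalIntegral.integral_of_le hδ.le, integral_rpow (Or.inl (by linarith))]
    rw [show 1 - a + 1 = 2 - a by ring, Real.zero_rpow (by linarith), sub_zero]
  · rw [← IntegrableOn, ← intervalIntegrable_iff_integrableOn_Ioc_of_le hδ.le]
    exact intervalIntegral.intervalIntegrable_rpow' (by linarith)
  · filter_upwards [ae_restrict_mem measurableSet_Ioc] with t ht
    have := ht.1
    dsimp only [Pi.zero_apply]; positivity

lemma Kf_bound {d : ℕ} (φ : Euc d → ℝ) (hφ : ContDiff ℝ 2 φ) (p : ℝ≥0∞) (hp : 1 ≤ p) (M : ℝ≥0∞)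
    (hM : ∀ i j, eLpNorm (pd i (pd j φ)) p volume ≤ M) (y z : Euc d) (hy : ‖y‖ ≤ 1) :
    eLpNorm (fun x => ‖Kf φ x y z‖ₑ) p volume ≤ ENNReal.ofReal d * M := by
  have hc := cont_pdpd φ hφ
  rw [eLpNorm_enorm]
  have e : (fun x => Kf φ x y z) =
      ∑ i, ∑ j, (y i * y j) • ((pd i (pd j φ)) ∘ fun x => x + z) := by
    ext x
    simp [Kf, Finset.sum_apply]
  have hcc : ∀ i j, Continuous ((y i * y j) • ((pd i (pd j φ)) ∘ fun x => x + z)) := by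
    intro i j
    exact ((hc i j).comp (by fun_prop)).const_smul _
  rw [e]
  calc eLpNorm (∑ i, ∑ j, (y i * y j) • ((pd i (pd j φ)) ∘ fun x => x + z)) p volume
      ≤ ∑ i, eLpNorm (∑ j, (y i * y j) • ((pd i (pd j φ)) ∘ fun x => x + z)) p volume := by
        apply eLpNorm_sum_le _ hp
        intro i _
        exact Finset.aestronglyMeasurable_sum _ fun j _ => (hcc i j).aestronglyMeasurable
    _ ≤ ∑ i, ∑ j, eLpNorm ((y i * y j) • ((pd i (pd j φ)) ∘ fun x => x + z)) p volume := by
        gcongr with i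
        apply eLpNorm_sum_le _ hp
        intro j _
        exact (hcc i j).aestronglyMeasurable
    _ ≤ ∑ i, ∑ j, ENNReal.ofReal (|y i| * |y j|) * M := by
        gcongr with i _ j _
        rw [eLpNorm_const_smul, eLpNorm_comp_measurePreserving (hc i j).aestronglyMeasurable
          (measurePreserving_add_right volume z)]
        gcongr
        · rw [Real.enorm_eq_ofReal_abs, abs_mul]
        · exact hM i j
    _ = ENNReal.ofReal ((∑ i, |y i|) ^ 2) * M := by
        simp_rw [← Finset.sum_mul]
        rw [pow_two, Finset.sum_mul_sum, ENNReal.ofReal_sum_of_nonneg]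
        · congr 1
          refine Finset.sum_congr rfl fun i _ => ?_
          rw [ENNReal.ofReal_sum_of_nonneg]
          intros; positivity
        · intros; positivity
    _ ≤ ENNReal.ofReal d * M := by
        gcongr
        have h1 := sq_sum_le_card_mul_sum_sq (s := Finset.univ) (f := fun i => |y i|)
        simp only [sq_abs, Finset.card_univ, Fintype.card_fin] at h1
        rw [← EuclideanSpace.real_norm_sq_eq] at h1
        refine h1.trans ?_
        have : ‖y‖ ^ 2 ≤ 1 := pow_le_one₀ (norm_nonneg _) hy
        nlinarith [(Nat.cast_nonneg d : (0:ℝ) ≤ d)]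

lemma meas_ballAvg {d : ℕ} (φ : Euc d → ℝ) (hc : Continuous φ) (x : Euc d) (a : ℝ) (s : Set ℝ)
    (hs : s ⊆ Ioi 0) (hsm : MeasurableSet s) :
    AEStronglyMeasurable (fun r => (ballAvg φ r x - φ x) / r ^ (1 + a)) (volume.restrict s) := by
  have h1 : StronglyMeasurable fun r : ℝ => ∫ y, φ (x + r • y) ∂Pm d := by
    have : Continuous (Function.uncurry fun (r : ℝ) (y : Euc d) => φ (x + r • y)) := by
      unfold Function.uncurry; fun_prop
    exact this.stronglyMeasurable.integral_prod_right
  have h2 : AEStronglyMeasurable (fun r => ((∫ y, φ (x + r • y) ∂Pm d) - φ x) / r ^ (1 + a))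
      (volume.restrict s) :=
    ((h1.measurable.sub_const _).div (by fun_prop)).aestronglyMeasurable
  refine h2.congr ?_
  filter_upwards [ae_restrict_mem hsm] with r hr
  rw [ballAvg_eq φ x r (hs hr)]

lemma bdd_ballAvg {d : ℕ} (φ : Euc d → ℝ) (hc : Continuous φ) (p : ℝ≥0∞) (hp : 1 ≤ p)
    (hφp : eLpNorm φ p volume < ⊤) (x : Euc d) (δ : ℝ) (hδ : 0 < δ) :
    ∃ C : ℝ, ∀ r, δ < r → |ballAvg φ r x| ≤ C := by
  set c : ℝ≥0∞ := (volume (ball x δ))⁻¹ with hcdef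
  have hct : c ≠ ⊤ := ENNReal.inv_ne_top.2 (measure_ball_pos _ _ hδ).ne'
  have hmem : MemLp φ p (c • volume) :=
    MemLp.smul_measure ⟨hc.aestronglyMeasurable, hφp⟩ hct
  refine ⟨(eLpNorm φ p (c • volume)).toReal, fun r hr => ?_⟩
  have hr0 : 0 < r := hδ.trans hr
  set μ : Measure (Euc d) := (volume (ball x r))⁻¹ • volume.restrict (ball x r) with hμ
  have hprob : IsProbabilityMeasure μ := by
    constructor
    simp only [hμ, Measure.smul_apply, Measure.restrict_apply_univ, smul_eq_mul]
    exact ENNReal.inv_mul_cancel (measure_ball_pos _ _ hr0).ne' measure_ball_lt_top.ne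
  have e : ballAvg φ r x = ∫ y, φ y ∂μ := by
    rw [hμ, integral_smul_measure, ballAvg, if_neg hr0.ne']
    simp
  have hle : μ ≤ c • volume := by
    rw [hμ]
    intro s
    simp only [Measure.smul_apply, smul_eq_mul]
    gcongr
    · exact ENNReal.inv_le_inv.2 (measure_mono (ball_subset_ball hr.le))
    · exact Measure.restrict_le_self
  have h1 : ‖ballAvg φ r x‖ₑ ≤ eLpNorm φ p (c • volume) := by
    rw [e]
    refine (enorm_integral_le_lintegral_enorm _).trans ?_
    rw [← eLpNorm_one_eq_lintegral_enorm]
    exact (eLpNorm_le_eLpNorm_of_exponent_le hp hc.aestronglyMeasurable).trans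
      (eLpNorm_mono_measure _ hle)
  have h2 := ENNReal.toReal_mono hmem.2.ne h1
  simpa using h2

theorem stmt17 (d : ℕ) (hd : 1 ≤ d) (u₀ : ℝ) (hu : 0 < u₀) (p : ℝ≥0∞) (hp : 1 ≤ p)
    (a : ℝ) (ha0 : 0 < a) (ha2 : a < 2)
    (δ : ℝ) (hδ0 : 0 < δ) (hδ1 : δ < 1)
    (φ : Euc d → ℝ) (hφ : ContDiff ℝ 2 φ)
    (hφp : eLpNorm φ p volume < ⊤)
    (hφ2 : (⨆ (l : List (Fin d)) (_ : l.length = 2), eLpNorm (listD l φ) p volume) < ⊤) :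
    eLpNorm (fun x =>
        (u₀ * V1 d * ∫ r in Set.Ioi δ, (ballAvg φ r x - φ x) / r ^ (1 + a))
        - u₀ * V1 d * ∫ r in Set.Ioi (0 : ℝ), (ballAvg φ r x - φ x) / r ^ (1 + a)) p volume
      ≤ ENNReal.ofReal (u₀ * V1 d * d / (2 * (2 - a)) * δ ^ (2 - a)) *
        ⨆ (l : List (Fin d)) (_ : l.length = 2), eLpNorm (listD l φ) p volume := by
  set M := ⨆ (l : List (Fin d)) (_ : l.length = 2), eLpNorm (listD l φ) p volume with hMdef
  have hM : ∀ i j, eLpNorm (pd i (pd j φ)) p volume ≤ M := fun i j =>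
    le_iSup₂_of_le (f := fun (l : List (Fin d)) (_ : l.length = 2) =>
      eLpNorm (listD l φ) p volume) [i, j] rfl le_rfl
  have hc := hφ.continuous
  have hcc := cont_pdpd φ hφ
  set ν : Measure (ℝ × Euc d × ℝ) := (Rm a δ).prod ((Pm d).prod Tm) with hν
  set G : Euc d → (ℝ × Euc d × ℝ) → ℝ≥0∞ :=
    fun x w => ‖Kf φ x w.2.1 (w.2.2 • w.1 • w.2.1)‖ₑ with hG
  have hGm : Measurable (Function.uncurry G) := by
    have : Continuous fun q : Euc d × (ℝ × Euc d × ℝ) =>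
        Kf φ q.1 q.2.2.1 (q.2.2.2 • q.2.1 • q.2.2.1) := by
      unfold Kf
      fun_prop
    exact this.enorm.measurable
  have hGx : ∀ x, Measurable (G x) := fun x => hGm.of_uncurry_left
  have hball : ∀ᵐ y ∂Pm d, ‖y‖ ≤ 1 := by
    unfold Pm
    apply Measure.ae_smul_measure
    filter_upwards [ae_restrict_mem measurableSet_ball] with y hy
    exact (mem_ball_zero_iff.1 hy).le
  have hGM : ∀ᵐ w ∂ν, eLpNorm (fun x => G x w) p volume ≤ ENNReal.ofReal d * M := by
    have h1 : ∀ᵐ w ∂ν, ‖w.2.1‖ ≤ 1 := by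
      have := (Measure.quasiMeasurePreserving_fst (μ := Pm d) (ν := Tm)).ae hball
      exact (Measure.quasiMeasurePreserving_snd (μ := Rm a δ) (ν := (Pm d).prod Tm)).ae this
    filter_upwards [h1] with w hw
    exact Kf_bound φ hφ p hp M hM _ _ hw
  have hmink := mink_aux volume ν G hGm p hp _ hGM
  have hνu : ν univ = ENNReal.ofReal (δ ^ (2 - a) / (2 - a) * (1 / 2)) := by
    rw [hν, ← univ_prod_univ, Measure.prod_prod, ← univ_prod_univ, Measure.prod_prod, Tm_univ,
      Rm_univ a δ ha2 hδ0, measure_univ, one_mul, ← ENNReal.ofReal_mul]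
    have : 0 < 2 - a := by linarith
    positivity
  -- pointwise bound
  have hloc : ∀ x, (∫⁻ r in Ioc 0 δ, ‖(ballAvg φ r x - φ x) / r ^ (1 + a)‖ₑ) ≤ ∫⁻ w, G x w ∂ν := by
    intro x
    rw [hν, lintegral_prod _ (hGx x).aemeasurable]
    unfold Rm
    rw [lintegral_withDensity_eq_lintegral_mul₀ (by fun_prop)
      (hGx x).lintegral_prod_right'.aemeasurable]
    apply lintegral_mono_ae
    filter_upwards [ae_restrict_mem measurableSet_Ioc] with r hr
    have hr0 : 0 < r := hr.1
    simp only [Pi.mul_apply]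
    rw [lintegral_prod (fun z : Euc d × ℝ => G x (r, z))
      ((hGx x).comp measurable_prodMk_left).aemeasurable]
    have hb := ballAvg_bound φ hφ x r hr0
    rw [div_eq_mul_inv, enorm_mul, ← Real.rpow_neg hr0.le, mul_comm]
    calc _ ≤ ‖r ^ (-(1 + a))‖ₑ * (ENNReal.ofReal (r ^ 2) *
          ∫⁻ y, ∫⁻ t, ‖Kf φ x y (t • r • y)‖ₑ ∂Tm ∂Pm d) := by gcongr
      _ = _ := by
        rw [← mul_assoc, Real.enorm_eq_ofReal (by positivity), ← ENNReal.ofReal_mul (by positivity),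
          ← Real.rpow_natCast, ← Real.rpow_add hr0]
        congr 3
        push_cast; ring
  have hpt : ∀ x, ‖(∫ r in Set.Ioi δ, (ballAvg φ r x - φ x) / r ^ (1 + a))
        - ∫ r in Set.Ioi (0 : ℝ), (ballAvg φ r x - φ x) / r ^ (1 + a)‖ₑ ≤ ‖∫⁻ w, G x w ∂ν‖ₑ := by
    intro x
    rw [enorm_eq_self]
    rcases eq_or_ne (∫⁻ w, G x w ∂ν) ⊤ with htop | htop
    · rw [htop]; exact le_top
    have hi1 : IntegrableOn (fun r => (ballAvg φ r x - φ x) / r ^ (1 + a)) (Ioc 0 δ) :=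
      ⟨meas_ballAvg φ hc x a _ (fun r hr => hr.1) measurableSet_Ioc,
        (hloc x).trans_lt (lt_top_iff_ne_top.2 htop)⟩
    have hi2 : IntegrableOn (fun r => (ballAvg φ r x - φ x) / r ^ (1 + a)) (Ioi δ) := by
      obtain ⟨C, hC⟩ := bdd_ballAvg φ hc p hp hφp x δ hδ0
      have hg : IntegrableOn (fun r : ℝ => (C + |φ x|) * r ^ (-(1 + a))) (Ioi δ) :=
        (integrableOn_Ioi_rpow_of_lt (by linarith) hδ0).const_mul _
      refine Integrable.mono' hg
        (meas_ballAvg φ hc x a _ (fun r hr => hδ0.trans hr) measurableSet_Ioi) ?_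
      filter_upwards [ae_restrict_mem measurableSet_Ioi] with r hr
      have hr0 : 0 < r := hδ0.trans hr
      rw [div_eq_mul_inv, ← Real.rpow_neg hr0.le, norm_mul,
        Real.norm_of_nonneg (Real.rpow_nonneg hr0.le _)]
      gcongr
      exact (abs_sub _ _).trans (by gcongr; exact hC r hr)
    rw [← Ioc_union_Ioi_eq_Ioi hδ0.le, setIntegral_union (Ioc_disjoint_Ioi le_rfl)
      measurableSet_Ioi hi1 hi2, sub_add_cancel_right, enorm_neg]
    exact (enorm_integral_le_lintegral_enorm _).trans (hloc x)
  have hV : 0 ≤ u₀ * V1 d := mul_nonneg hu.le ENNReal.toReal_nonneg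
  have e : (fun x =>
        (u₀ * V1 d * ∫ r in Set.Ioi δ, (ballAvg φ r x - φ x) / r ^ (1 + a))
        - u₀ * V1 d * ∫ r in Set.Ioi (0 : ℝ), (ballAvg φ r x - φ x) / r ^ (1 + a)) =
      (u₀ * V1 d) • fun x => (∫ r in Set.Ioi δ, (ballAvg φ r x - φ x) / r ^ (1 + a))
        - ∫ r in Set.Ioi (0 : ℝ), (ballAvg φ r x - φ x) / r ^ (1 + a) := by
    ext x
    simp only [Pi.smul_apply, smul_eq_mul]
    ring
  rw [e, eLpNorm_const_smul, Real.enorm_eq_ofReal hV]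
  calc _ ≤ ENNReal.ofReal (u₀ * V1 d) * (ν univ * (ENNReal.ofReal d * M)) := by
        gcongr
        exact (eLpNorm_mono_enorm hpt).trans hmink
    _ = _ := by
        have h2a : 0 < 2 - a := by linarith
        rw [hνu, ← mul_assoc, ← mul_assoc, ← ENNReal.ofReal_mul hV,
          ← ENNReal.ofReal_mul (by positivity)]
        congr 2
        field_simp

end
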